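/- arXiv:2503.20155 — 3 statements merged into one kernel-verified Lean document; each statement's English description precedes it below -/
import Mathlib

section
/- Let m > n be positive integers. Then the statistics ret, run and r̃un are equidistributed on D_{m,n}: ∑_{P ∈ D_{m,n}} q^{ret(P)} = ∑_{P ∈ D_{m,n}} q^{run(P)} = ∑_{P ∈ D_{m,n}} q^{r̃un(P)} as polynomials in the indeterminate q. -/
open scoped Classical

namespace RationalDyck

/-- A lattice path: `true` = a north step `N`, `false` = an east step `E`. -/
abbrev Path : Type := List Bool

/-- The rank of the endpoint of a path prefix `Q` in the `m × n` grid: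
`rank(i,j) = j*m - i*n`, where `i` is the number of east steps of `Q`
and `j` the number of north steps of `Q`. -/
def prefRank (m n : ℕ) (Q : Path) : ℤ :=
  (Q.count true : ℤ) * m - (Q.count false : ℤ) * n

/-- `P` is an `m × n` rational Dyck path: it goes from `(0,0)` to `(m,n)` and
stays weakly above the line `y = n x / m`. -/
def IsDyck (m n : ℕ) (P : Path) : Prop :=
  P.count false = m ∧ P.count true = n ∧ ∀ i ≤ P.length, 0 ≤ prefRank m n (P.take i)

/-- The return statistic: the number of lattice points on `P` other than `(m,n)`
whose rank is strictly less than `n`. -/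
def retStat (m n : ℕ) (P : Path) : ℕ :=
  ((List.range P.length).filter fun i => prefRank m n (P.take i) < (n : ℤ)).length

/-- The coarea sequence of `P`: for each north step (from bottom to top), the number
of cells of the rectangle strictly to its left, i.e. the number of east steps before it. -/
def coarea (P : Path) : List ℕ :=
  (List.range P.length).filterMap fun i =>
    if P.getD i false = true then some ((P.take i).count false) else none

/-- The run statistic: the least `i ∈ [n]` not appearing in the coarea sequence. -/
noncomputable def runStat (P : Path) : ℕ :=
  sInf {i : ℕ | 1 ≤ i ∧ i ≤ P.count true ∧ i ∉ coarea P}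

/-- The ratio-run statistic: with `k = ⌊m/n⌋`, the least `i ∈ [n]` such that `k*i`
does not appear in the coarea sequence. -/
noncomputable def ratioRun (m n : ℕ) (P : Path) : ℕ :=
  sInf {i : ℕ | 1 ≤ i ∧ i ≤ P.count true ∧ (m / n) * i ∉ coarea P}

/-- The composition type of `P`: the lengths of the maximal blocks of consecutive
north steps, read from start to end. -/
def compType (P : Path) : List ℕ :=
  ((P.splitOn false).map List.length).filter fun x => x ≠ 0

/-- The number of maximal blocks of consecutive north steps (vertical components). -/
def nc (P : Path) : ℕ := (compType P).length

/-- `α` is a (strong) composition of `n`. -/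
def IsComposition (n : ℕ) (α : List ℕ) : Prop :=
  (∀ a ∈ α, 0 < a) ∧ α.sum = n

/-- The finite set of all `m × n` rational Dyck paths. -/
noncomputable def dyckPaths (m n : ℕ) : Finset Path :=
  ((Finset.univ : Finset (Fin (m + n) → Bool)).image List.ofFn).filter fun P => IsDyck m n P

/-- The `m × n` rational Dyck paths of composition type `α`. -/
noncomputable def dyckPathsComp (m n : ℕ) (α : List ℕ) : Finset Path :=
  (dyckPaths m n).filter fun P => compType P = α

/-- The `m × n` rational Dyck paths with `run = k` and `ret = l`. -/
noncomputable def dyckPathsRR (m n k l : ℕ) : Finset Path :=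
  (dyckPaths m n).filter fun P => runStat P = k ∧ retStat m n P = l

/-- The `m × n` rational Dyck paths of composition type `α` with `run = k` and `ret = l`. -/
noncomputable def dyckPathsCompRR (m n : ℕ) (α : List ℕ) (k l : ℕ) : Finset Path :=
  (dyckPathsComp m n α).filter fun P => runStat P = k ∧ retStat m n P = l

/-- The number of initial parts of `α` equal to `1`. -/
def iones (α : List ℕ) : ℕ := (α.takeWhile fun a => a = 1).length

/-- `rr(α, m) = min(Iones(α) + 1, ⌈n/(m-n)⌉)` where `n = |α|` is the sum of parts. -/
def rr (m : ℕ) (α : List ℕ) : ℕ :=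
  min (iones α + 1) ((α.sum + (m - α.sum) - 1) / (m - α.sum))

/-- All paths with exactly `L` steps. -/
noncomputable def words : ℕ → Finset Path
  | 0 => {[]}
  | L + 1 => (words L).image (List.cons true) ∪ (words L).image (List.cons false)

theorem mem_words {L : ℕ} {P : Path} : P ∈ words L ↔ P.length = L := by
  induction L generalizing P with
  | zero => simp [words]
  | succ L ih =>
    rcases P with _ | ⟨_ | _, P⟩ <;> simp [words, ih]

/-- The number of paths with `L` steps satisfying `p`. -/
noncomputable def cnt (L : ℕ) (p : Path → Prop) : ℕ := ((words L).filter p).card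

theorem cnt_succ (L : ℕ) (p : Path → Prop) :
    cnt (L + 1) p = cnt L (fun P => p (true :: P)) + cnt L (fun P => p (false :: P)) := by
  unfold cnt
  rw [words, Finset.filter_union, Finset.card_union_of_disjoint, Finset.filter_image,
    Finset.filter_image, Finset.card_image_of_injective _ List.cons_injective,
    Finset.card_image_of_injective _ List.cons_injective]
  rw [Finset.disjoint_left]
  intro P hP hP'
  simp only [Finset.mem_filter, Finset.mem_image] at hP hP'
  obtain ⟨⟨Q, -, rfl⟩, -⟩ := hP
  obtain ⟨⟨R, -, hR⟩, -⟩ := hP'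
  simp at hR

theorem cnt_eq_zero {L : ℕ} {p : Path → Prop} (h : ∀ P, ¬ p P) : cnt L p = 0 := by
  simp [cnt, h]

theorem cnt_congr {L : ℕ} {p p' : Path → Prop} (h : ∀ P, p P ↔ p' P) : cnt L p = cnt L p' := by
  simp [cnt, h]

theorem cnt_zero_of {p : Path → Prop} (h : p []) : cnt 0 p = 1 := by
  simp [cnt, words, Finset.filter_singleton, h]

theorem cnt_zero_of_not {p : Path → Prop} (h : ¬ p []) : cnt 0 p = 0 := by
  simp [cnt, words, Finset.filter_singleton, h]

/-- `Good m n i j P` says that `P`, started at `(i, j)`, ends at `(m, n)` and stays weakly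
above the diagonal. -/
def Good (m n : ℕ) : ℕ → ℕ → Path → Prop
  | i, j, [] => i = m ∧ j = n
  | i, j, true :: P => i * n ≤ j * m ∧ Good m n i (j + 1) P
  | i, j, false :: P => i * n ≤ j * m ∧ Good m n (i + 1) j P

/-- The number of points of rank less than `n`, other than the last point, on the path `P`
started at `(i, j)`. -/
def touches (m n : ℕ) : ℕ → ℕ → Path → ℕ
  | _, _, [] => 0
  | i, j, true :: P => (if j * m < (i + 1) * n then 1 else 0) + touches m n i (j + 1) P
  | i, j, false :: P => (if j * m < (i + 1) * n then 1 else 0) + touches m n (i + 1) j P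

/-- The abscissas of the north steps of the path `P` started at abscissa `i`. -/
def columns : ℕ → Path → List ℕ
  | _, [] => []
  | i, true :: P => i :: columns i P
  | i, false :: P => columns (i + 1) P

theorem Good.valid {m n i j : ℕ} {P : Path} (h : Good m n i j P) : i * n ≤ j * m := by
  rcases P with _ | ⟨_ | _, P⟩
  · obtain ⟨rfl, rfl⟩ := h
    exact (mul_comm _ _).le
  · exact h.1
  · exact h.1

theorem Good.le {m n i j : ℕ} {P : Path} (h : Good m n i j P) : j ≤ n := by
  induction P generalizing i j with
  | nil => exact h.2.le
  | cons b P ih =>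
    cases b
    · exact ih h.2
    · exact (Nat.le_succ j).trans (ih h.2)

theorem le_of_mem_columns {i x : ℕ} {P : Path} (h : x ∈ columns i P) : i ≤ x := by
  induction P generalizing i with
  | nil => simp [columns] at h
  | cons b P ih =>
    cases b
    · exact (Nat.le_succ i).trans (ih h)
    · rcases List.mem_cons.1 h with rfl | h
      · exact le_rfl
      · exact ih h

/-- The number of ways to complete a path from `(i, j)` to `(m, n)`. -/
noncomputable def completions (m n i j : ℕ) : ℕ := cnt (m + n - i - j) (Good m n i j)

theorem completions_eq_zero {m n i j : ℕ} (h : n < j) : completions m n i j = 0 :=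
  cnt_eq_zero fun _ hP => h.not_ge hP.le

theorem completions_rec {m n i j : ℕ} (hv : i * n ≤ j * m) (hi : i < m) :
    completions m n i j = completions m n i (j + 1) + completions m n (i + 1) j := by
  rcases lt_or_ge n j with hj | hj
  · simp [completions_eq_zero hj, completions_eq_zero (hj.trans (Nat.lt_succ_self j))]
  · obtain ⟨L, hL⟩ : ∃ L, m + n - i - j = L + 1 := ⟨m + n - i - j - 1, by omega⟩
    have h₁ : m + n - i - (j + 1) = L := by omega
    have h₂ : m + n - (i + 1) - j = L := by omega
    simp only [completions, hL, h₁, h₂, cnt_succ, Good, hv, true_and]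

theorem eq_of_add_eq {m n i j : ℕ} (hn : 0 < n) (hv : i * n ≤ j * m) (hj : j ≤ n)
    (h : i + j = m + n) : i = m ∧ j = n := by
  have : i * n ≤ m * n := hv.trans ((Nat.mul_le_mul_right m hj).trans (mul_comm n m).le)
  have := Nat.le_of_mul_le_mul_right this hn
  omega

theorem lt_of_succ_valid {m n i j : ℕ} (hn : 0 < n) (hv : (i + 1) * n ≤ j * m) (hj : j ≤ n) :
    i < m := by
  have : (i + 1) * n ≤ m * n := hv.trans ((Nat.mul_le_mul_right m hj).trans (mul_comm n m).le)
  exact Nat.le_of_mul_le_mul_right this hn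

theorem cnt_le_touches {m n : ℕ} (hn : 0 < n) (L r i j : ℕ) (hv : i * n ≤ j * m)
    (hL : L + i + j = m + n) :
    cnt L (fun P => Good m n i j P ∧ r ≤ touches m n i j P) = completions m n i (j + r) := by
  induction L generalizing i j r with
  | zero =>
    rcases lt_or_ge n j with hj | hj
    · rw [completions_eq_zero (by omega), cnt_eq_zero fun P h => hj.not_ge h.1.le]
    obtain ⟨rfl, rfl⟩ := eq_of_add_eq hn hv hj (by omega)
    rcases Nat.eq_zero_or_pos r with rfl | hr
    · rw [cnt_zero_of ⟨⟨rfl, rfl⟩, Nat.zero_le _⟩, completions, add_zero,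
        show i + j - i - j = 0 by omega, cnt_zero_of ⟨rfl, rfl⟩]
    · rw [completions_eq_zero (by omega), cnt_zero_of_not fun h => hr.not_ge h.2]
  | succ L ih =>
    rcases lt_or_ge n j with hj | hj
    · rw [completions_eq_zero (by omega), cnt_eq_zero fun P h => hj.not_ge h.1.le]
    have hv' : i * n ≤ (j + 1) * m := hv.trans (Nat.mul_le_mul_right m (Nat.le_succ j))
    rcases lt_or_ge (j * m) ((i + 1) * n) with ht | ht
    · cases r with
      | zero =>
        simp only [Nat.zero_le, and_true, completions, add_zero,
          show m + n - i - j = L + 1 by omega]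
      | succ r =>
        rw [cnt_succ, cnt_eq_zero (p := fun P => Good m n i j (false :: P) ∧ _)
          fun P h => ht.not_ge h.1.2.valid, show j + (r + 1) = j + 1 + r by omega,
          ← ih r i (j + 1) hv' (by omega), add_zero]
        refine cnt_congr fun P => ?_
        simp only [Good, touches, hv, ht, true_and, if_true]
        rw [add_comm r 1, Nat.add_le_add_iff_left]
    · have hi := lt_of_succ_valid hn ht hj
      rw [completions_rec (hv.trans (Nat.mul_le_mul_right m (Nat.le_add_right j r))) hi,
        show j + r + 1 = j + 1 + r by omega, ← ih r i (j + 1) hv' (by omega),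
        ← ih r (i + 1) j ht (by omega), cnt_succ]
      simp only [Good, touches, hv, ht.not_gt, true_and, if_false, zero_add]

theorem cnt_mem_columns {m n : ℕ} (hn : 0 < n) {a : ℕ → ℕ} (ha : StrictMono a)
    (hle : ∀ t, a t * n ≤ t * m) {r : ℕ} (L s i j : ℕ) (hv : i * n ≤ j * m)
    (hL : L + i + j = m + n) (hs : s ≤ j) (hsr : s ≤ r) (hi : s < r → i ≤ a s) :
    cnt L (fun P => Good m n i j P ∧ ∀ t, s ≤ t → t < r → a t ∈ columns i P) =
      completions m n i (j + (r - s)) := by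
  induction L generalizing i j s with
  | zero =>
    rcases lt_or_ge n j with hj | hj
    · rw [completions_eq_zero (by omega), cnt_eq_zero fun P h => hj.not_ge h.1.le]
    obtain ⟨rfl, rfl⟩ := eq_of_add_eq hn hv hj (by omega)
    rcases hsr.eq_or_lt with rfl | hr
    · rw [cnt_zero_of ⟨⟨rfl, rfl⟩, fun t h h' => absurd h' h.not_gt⟩, completions, Nat.sub_self,
        add_zero, show i + j - i - j = 0 by omega, cnt_zero_of ⟨rfl, rfl⟩]
    · rw [completions_eq_zero (by omega), cnt_zero_of_not fun h => by
        simpa [columns] using h.2 s le_rfl hr]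
  | succ L ih =>
    rcases lt_or_ge n j with hj | hj
    · rw [completions_eq_zero (by omega), cnt_eq_zero fun P h => hj.not_ge h.1.le]
    have hv' : i * n ≤ (j + 1) * m := hv.trans (Nat.mul_le_mul_right m (Nat.le_succ j))
    rcases hsr.eq_or_lt with rfl | hr
    · rw [Nat.sub_self, add_zero, completions, show m + n - i - j = L + 1 by omega]
      exact cnt_congr fun P => and_iff_left fun t h h' => absurd h' h.not_gt
    rcases (hi hr).eq_or_lt with his | his
    · rw [cnt_succ, cnt_eq_zero (p := fun P => Good m n i j (false :: P) ∧
          ∀ t, s ≤ t → t < r → a t ∈ columns i (false :: P))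
          fun P h => absurd (le_of_mem_columns (P := P) (i := i + 1) (h.2 s le_rfl hr)) (by omega),
        show j + (r - s) = j + 1 + (r - (s + 1)) by omega, add_zero,
        ← ih (s + 1) i (j + 1) hv' (by omega) (by omega) hr
          fun _ => his.le.trans (ha.monotone (Nat.le_succ s))]
      refine cnt_congr fun P => ?_
      simp only [Good, columns, hv, true_and, List.mem_cons]
      refine and_congr_right fun _ => ⟨fun h t h₁ h₂ => ?_, fun h t h₁ h₂ => ?_⟩
      · have := ha (Nat.lt_of_succ_le h₁)
        exact (h t (by omega) h₂).resolve_left (by omega)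
      · rcases h₁.eq_or_lt with rfl | h₁
        · exact Or.inl his.symm
        · exact Or.inr (h t h₁ h₂)
    · have ht : (i + 1) * n ≤ j * m := (Nat.mul_le_mul_right n his).trans
        ((hle s).trans (Nat.mul_le_mul_right m hs))
      have him := lt_of_succ_valid hn ht hj
      rw [completions_rec (hv.trans (Nat.mul_le_mul_right m (Nat.le_add_right j _))) him,
        show j + (r - s) + 1 = j + 1 + (r - s) by omega,
        ← ih s i (j + 1) hv' (by omega) (by omega) hsr hi,
        ← ih s (i + 1) j ht (by omega) hs hsr fun _ => his, cnt_succ]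
      simp only [Good, columns, hv, true_and, List.mem_cons]
      congr 1
      refine cnt_congr fun P => and_congr_right fun _ =>
        forall_congr' fun t => forall_congr' fun h => forall_congr' fun _ => or_iff_right ?_
      have := ha.monotone h
      omega

theorem good_iff (m n i j : ℕ) (P : Path) :
    Good m n i j P ↔ i + P.count false = m ∧ j + P.count true = n ∧
      ∀ l ≤ P.length, 0 ≤ (j * m - i * n : ℤ) + prefRank m n (P.take l) := by
  induction P generalizing i j with
  | nil =>
    simp only [Good, prefRank, List.count_nil, add_zero, List.length_nil, List.take_nil]
    refine and_congr_right fun h => (and_iff_left_of_imp ?_).symm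
    rintro h' - -
    rw [← h, ← h']
    push_cast
    nlinarith
  | cons b P ih =>
    have hz : (0 : ℤ) ≤ (j * m - i * n : ℤ) ↔ i * n ≤ j * m := by
      rw [sub_nonneg]
      norm_cast
    have key : (∀ l ≤ (b :: P).length,
          0 ≤ (j * m - i * n : ℤ) + prefRank m n ((b :: P).take l)) ↔
        i * n ≤ j * m ∧
          ∀ l ≤ P.length, 0 ≤ (j * m - i * n : ℤ) + prefRank m n (b :: P.take l) := by
      rw [← hz]
      refine ⟨fun h => ⟨by simpa [prefRank] using h 0 (Nat.zero_le _), fun l hl => ?_⟩,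
        fun h l hl => ?_⟩
      · simpa using h (l + 1) (by simpa using hl)
      · cases l with
        | zero => simpa [prefRank] using h.1
        | succ l => simpa using h.2 l (by simpa using hl)
    rw [key]
    cases b
    · rw [Good, ih]
      have : ∀ Q : Path, (j * m - i * n : ℤ) + prefRank m n (false :: Q) =
          (j * m - (i + 1 : ℕ) * n : ℤ) + prefRank m n Q := by
        intro Q
        simp only [prefRank, List.count_cons_self, List.count_cons_of_ne (by decide : false ≠ true)]
        push_cast
        ring
      simp only [this, List.count_cons_self, List.count_cons_of_ne (by decide : false ≠ true)]
      rw [show i + 1 + List.count false P = i + (List.count false P + 1) by omega]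
      tauto
    · rw [Good, ih]
      have : ∀ Q : Path, (j * m - i * n : ℤ) + prefRank m n (true :: Q) =
          ((j + 1 : ℕ) * m - i * n : ℤ) + prefRank m n Q := by
        intro Q
        simp only [prefRank, List.count_cons_self, List.count_cons_of_ne (by decide : true ≠ false)]
        push_cast
        ring
      simp only [this, List.count_cons_self, List.count_cons_of_ne (by decide : true ≠ false)]
      rw [show j + 1 + List.count true P = j + (List.count true P + 1) by omega]
      tauto

theorem isDyck_iff (m n : ℕ) (P : Path) : IsDyck m n P ↔ Good m n 0 0 P := by
  rw [good_iff]
  simp [IsDyck]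

theorem dyckPaths_eq (m n : ℕ) : dyckPaths m n = (words (m + n)).filter (Good m n 0 0) := by
  ext P
  simp only [dyckPaths, Finset.mem_filter, isDyck_iff, mem_words]
  refine and_congr_left fun _ => ?_
  simp only [Finset.mem_image, Finset.mem_univ, true_and]
  constructor
  · rintro ⟨f, rfl⟩
    simp
  · intro h
    rw [← h]
    exact ⟨P.get, List.ofFn_get P⟩

theorem touches_eq (m n i j : ℕ) (P : Path) :
    ((List.range P.length).filter fun l =>
      (j * m - i * n : ℤ) + prefRank m n (P.take l) < (n : ℤ)).length = touches m n i j P := by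
  induction P generalizing i j with
  | nil => simp [touches]
  | cons b P ih =>
    have hz : ((j * m - i * n : ℤ) + prefRank m n [] < n) ↔ j * m < (i + 1) * n := by
      simp only [prefRank, List.count_nil]
      zify
      constructor <;> intro h <;> linarith
    rw [List.length_cons, List.range_succ_eq_map, ← List.countP_eq_length_filter,
      List.countP_cons, List.countP_map, List.take_zero, add_comm]
    cases b
    · rw [touches, ← ih, ← List.countP_eq_length_filter]
      congr 1
      · simp [hz]
      · congr 1
        funext l
        simp only [Function.comp, prefRank, List.take_succ_cons, List.count_cons_self,
          List.count_cons_of_ne (by decide : false ≠ true)]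
        congr 2
        push_cast
        ring
    · rw [touches, ← ih, ← List.countP_eq_length_filter]
      congr 1
      · simp [hz]
      · congr 1
        funext l
        simp only [Function.comp, prefRank, List.take_succ_cons, List.count_cons_self,
          List.count_cons_of_ne (by decide : true ≠ false)]
        congr 2
        push_cast
        ring

theorem retStat_eq (m n : ℕ) (P : Path) : retStat m n P = touches m n 0 0 P := by
  rw [← touches_eq]
  simp [retStat]

theorem columns_eq (i : ℕ) (P : Path) :
    ((List.range P.length).filterMap fun l =>
      if P.getD l false = true then some (i + (P.take l).count false) else none) =
      columns i P := by
  induction P generalizing i with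
  | nil => simp [columns]
  | cons b P ih =>
    rw [List.length_cons, List.range_succ_eq_map, List.filterMap_cons, List.filterMap_map]
    cases b
    · rw [columns, ← ih]
      simp [add_assoc, add_comm 1]
    · rw [columns, ← ih]
      simp

theorem coarea_eq (P : Path) : coarea P = columns 0 P := by
  rw [← columns_eq]
  simp [coarea]

theorem card_le_retStat {m n : ℕ} (hn : 0 < n) (r : ℕ) :
    ((dyckPaths m n).filter fun P => r ≤ retStat m n P).card = completions m n 0 r := by
  rw [dyckPaths_eq, Finset.filter_filter]
  simp only [retStat_eq]
  have h := cnt_le_touches (m := m) hn (m + n) r 0 0 (by simp) (by simp)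
  rw [zero_add, cnt] at h
  convert h

theorem card_mem_coarea {m n : ℕ} (hn : 0 < n) {a : ℕ → ℕ} (ha : StrictMono a)
    (hle : ∀ t, a t * n ≤ t * m) (r : ℕ) :
    ((dyckPaths m n).filter fun P => ∀ t < r, a t ∈ coarea P).card = completions m n 0 r := by
  rw [dyckPaths_eq, Finset.filter_filter]
  simp only [coarea_eq]
  simpa [cnt] using cnt_mem_columns hn ha hle (r := r) (m + n) 0 0 0 (by simp) (by simp) le_rfl
    (Nat.zero_le _) (fun _ => Nat.zero_le _)

theorem zero_mem_coarea {m n : ℕ} (hn : 0 < n) {P : Path} (hP : P ∈ dyckPaths m n) :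
    0 ∈ coarea P := by
  rw [dyckPaths_eq, Finset.mem_filter] at hP
  rw [coarea_eq]
  rcases P with _ | ⟨_ | _, P⟩
  · exact absurd hP.2.2 hn.ne
  · have := hP.2.2.valid
    omega
  · simp [columns]

theorem card_le_sInf {m n : ℕ} (hn : 0 < n) {a : ℕ → ℕ} (ha : StrictMono a) (ha₀ : a 0 = 0)
    (hle : ∀ t, a t * n ≤ t * m) (r : ℕ) :
    ((dyckPaths m n).filter fun P =>
      r ≤ sInf {i : ℕ | 1 ≤ i ∧ i ≤ P.count true ∧ a i ∉ coarea P}).card =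
      completions m n 0 r := by
  rw [← card_mem_coarea hn ha hle r]
  congr 1
  refine Finset.filter_congr fun P hP => ?_
  have h₀ := zero_mem_coarea hn hP
  have hcount : P.count true = n := (Finset.mem_filter.1 hP).2.2.1
  rw [hcount]
  have hne : {i : ℕ | 1 ≤ i ∧ i ≤ n ∧ a i ∉ coarea P}.Nonempty := by
    by_contra hempty
    have hcard := card_mem_coarea (m := m) hn ha hle (n + 1)
    rw [completions_eq_zero (Nat.lt_succ_self n), Finset.card_eq_zero,
      Finset.filter_eq_empty_iff] at hcard
    refine hcard hP fun t ht => ?_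
    by_contra hmem
    refine hempty ⟨t, Nat.one_le_iff_ne_zero.2 ?_, by omega, hmem⟩
    rintro rfl
    exact hmem (ha₀.symm ▸ h₀)
  refine ⟨fun h t ht => ?_, fun h => le_csInf hne fun i hi => ?_⟩
  · rcases Nat.eq_zero_or_pos t with rfl | htpos
    · exact ha₀.symm ▸ h₀
    · have hn' := (Nat.sInf_mem hne).2.1
      by_contra hmem
      exact Nat.notMem_of_lt_sInf (ht.trans_le h) ⟨htpos, by omega, hmem⟩
  · by_contra hlt
    exact hi.2.2 (h i (not_le.1 hlt))

theorem sum_comp_eq_of_card_le_eq {α M : Type*} [AddCommMonoid M] (s : Finset α) (f g : α → ℕ)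
    (h : ∀ r, (s.filter fun x => r ≤ f x).card = (s.filter fun x => r ≤ g x).card) (F : ℕ → M) :
    ∑ x ∈ s, F (f x) = ∑ x ∈ s, F (g x) := by
  have key : ∀ (e : α → ℕ) (r : ℕ), (s.filter fun x => r ≤ e x).card =
      (s.filter fun x => e x = r).card + (s.filter fun x => r + 1 ≤ e x).card := by
    intro e r
    rw [← Finset.card_union_of_disjoint, ← Finset.filter_or]
    · congr 1
      exact Finset.filter_congr fun x _ => by omega
    · exact Finset.disjoint_filter.2 fun x _ h₁ h₂ => by omega
  have hmap : s.val.map f = s.val.map g := by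
    ext r
    rw [Multiset.count_map, Multiset.count_map]
    have h₁ := key f r
    have h₂ := key g r
    rw [h r, h (r + 1)] at h₁
    have : (s.filter fun x => f x = r).card = (s.filter fun x => g x = r).card := by omega
    simpa [Finset.card_def, eq_comm] using this
  calc ∑ x ∈ s, F (f x) = ((s.val.map f).map F).sum := by rw [Multiset.map_map]; rfl
    _ = ∑ x ∈ s, F (g x) := by rw [hmap, Multiset.map_map]; rfl

theorem card_le_runStat {m n : ℕ} (hn : 0 < n) (hmn : n ≤ m) (r : ℕ) :
    ((dyckPaths m n).filter fun P => r ≤ runStat P).card = completions m n 0 r :=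
  card_le_sInf hn strictMono_id rfl (fun t => Nat.mul_le_mul_left t hmn) r

theorem card_le_ratioRun {m n : ℕ} (hn : 0 < n) (hmn : n ≤ m) (r : ℕ) :
    ((dyckPaths m n).filter fun P => r ≤ ratioRun m n P).card = completions m n 0 r := by
  refine card_le_sInf hn (a := fun i => m / n * i)
    (fun x y hxy => Nat.mul_lt_mul_of_pos_left hxy (Nat.div_pos hmn hn)) (mul_zero _)
    (fun t => ?_) r
  calc m / n * t * n = t * (m / n * n) := by ring
    _ ≤ t * m := Nat.mul_le_mul_left t (Nat.div_mul_le_self m n)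

/-- For `m > n`, the statistics `ret`, `run` and `r̃un` are
equidistributed on `D_{m,n}`. -/
theorem equidistributed (m n : ℕ) (hn : 0 < n) (hmn : n < m) :
    (∑ P ∈ dyckPaths m n, (Polynomial.X : Polynomial ℚ) ^ retStat m n P) =
        (∑ P ∈ dyckPaths m n, (Polynomial.X : Polynomial ℚ) ^ runStat P) ∧
      (∑ P ∈ dyckPaths m n, (Polynomial.X : Polynomial ℚ) ^ runStat P) =
        ∑ P ∈ dyckPaths m n, (Polynomial.X : Polynomial ℚ) ^ ratioRun m n P := by
  have hret := card_le_retStat (m := m) hn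
  have hrun := card_le_runStat hn hmn.le
  have hratio := card_le_ratioRun hn hmn.le
  exact ⟨sum_comp_eq_of_card_le_eq _ _ _ (fun r => (hret r).trans (hrun r).symm) _,
    sum_comp_eq_of_card_le_eq _ _ _ (fun r => (hrun r).trans (hratio r).symm) _⟩

end RationalDyck
end

section
/- Let m > n be positive integers, let P ∈ D_{m,n} with comp(P) = α = (α_1,…,α_ℓ), and for each i ≤ ℓ let e_i denote the lattice point of P reached at the end of the east step immediately following the i-th maximal block of consecutive north steps of P. Let s be the largest integer s ≥ 0 such that rank(e_i) < n for all 1 ≤ i ≤ s. Then s + 1 = min{ Iones(α) + 1, ⌈ n/(m−n) ⌉ } = rr(α,m). -/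
open scoped Classical

namespace RationalDyck

/-- The list of indices of the north steps of `P`, in order. -/
def northIdx (P : Path) : List ℕ :=
  (List.range P.length).filter fun i => P.getD i false = true

/-- The rank of the lattice point reached at the end of the east step immediately
following the `c`-th north step of `P` (counting north steps from `1`): the endpoint of
the prefix of `P` of length (index of the `c`-th north step) + 2. -/
def afterBlockRank (m n : ℕ) (P : Path) (c : ℕ) : ℤ :=
  prefRank m n (P.take ((northIdx P).getD (c - 1) 0 + 2))

theorem prefRank_append (m n : ℕ) (A B : Path) :
    prefRank m n (A ++ B) = prefRank m n A + prefRank m n B := by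
  simp only [prefRank, List.count_append]
  push_cast
  ring

theorem splitOn_cons_true (P : Path) :
    (true :: P).splitOn false = (P.splitOn false).modifyHead (List.cons true) :=
  List.splitOnP_cons_eq_if_modifyHead ..

theorem splitOn_cons_false (P : Path) :
    (false :: P).splitOn false = [] :: P.splitOn false :=
  List.splitOnP_cons_eq_if_modifyHead ..

theorem sum_map_length_splitOn_false (P : Path) :
    ((P.splitOn false).map List.length).sum = P.count true := by
  induction P with
  | nil => simp
  | cons x P ih =>
    cases x
    · simp [splitOn_cons_false, ih]
    · obtain ⟨y, l, hl⟩ : ∃ y l, P.splitOn false = y :: l :=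
        List.exists_cons_of_ne_nil (List.splitOnP_ne_nil _ P)
      rw [hl] at ih
      rw [splitOn_cons_true, hl, List.count_cons_self, ← ih]
      simp [Nat.add_right_comm]

theorem sum_compType (P : Path) : (compType P).sum = P.count true := by
  rw [← sum_map_length_splitOn_false, compType]
  induction (P.splitOn false).map List.length with
  | nil => rfl
  | cons a l ih => by_cases h : a = 0 <;> simpa [h] using ih

theorem splitOn_block (a : ℕ) (Q : Path) :
    (List.replicate a true ++ false :: Q).splitOn false =
      List.replicate a true :: Q.splitOn false := by
  induction a with
  | zero => exact splitOn_cons_false Q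
  | succ a ih =>
    rw [List.replicate_succ, List.cons_append, splitOn_cons_true, ih, List.modifyHead_cons]

theorem compType_block {a : ℕ} (ha : 0 < a) (Q : Path) :
    compType (List.replicate a true ++ false :: Q) = a :: compType Q := by
  simp [compType, ha.ne', splitOn_block]

/-- The staircase path `(NE)^j`. -/
def stair (j : ℕ) : Path := (List.replicate j [true, false]).flatten

theorem stair_succ (j : ℕ) : stair (j + 1) = stair j ++ [true, false] := by
  simp [stair, List.replicate_succ']

theorem count_true_stair (j : ℕ) : (stair j).count true = j := by
  induction j with
  | zero => rfl
  | succ j ih => simp [stair_succ, ih]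

theorem count_false_stair (j : ℕ) : (stair j).count false = j := by
  induction j with
  | zero => rfl
  | succ j ih => simp [stair_succ, ih]

theorem prefRank_stair (m n j : ℕ) : prefRank m n (stair j) = j * ((m : ℤ) - n) := by
  rw [prefRank, count_true_stair, count_false_stair]
  ring

theorem compType_stair_append (j : ℕ) (Q : Path) :
    compType (stair j ++ Q) = List.replicate j 1 ++ compType Q := by
  induction j with
  | zero => rfl
  | succ j ih =>
    have h : stair (j + 1) ++ Q = List.replicate 1 true ++ false :: (stair j ++ Q) := by
      simp [stair, List.replicate_succ]
    rw [h, compType_block one_pos, ih, List.replicate_succ, List.cons_append]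

theorem northIdx_append (A B : Path) :
    northIdx (A ++ B) = northIdx A ++ (northIdx B).map (A.length + ·) := by
  simp only [northIdx, List.length_append, List.range_add, List.filter_append, List.filter_map]
  congr 1
  · refine List.filter_congr fun i hi => ?_
    rw [List.getD_append _ _ _ _ (List.mem_range.1 hi)]
  · congr 1
    refine List.filter_congr fun i _ => ?_
    simp [List.getElem?_append_right]

theorem length_northIdx (P : Path) : (northIdx P).length = P.count true := by
  induction P with
  | nil => rfl
  | cons x P ih =>
    rw [← List.singleton_append, northIdx_append, List.length_append, List.length_map, ih,
      List.count_append]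
    cases x <;> rfl

theorem afterBlockRank_append (m n : ℕ) (A B : Path) :
    afterBlockRank m n (A ++ true :: false :: B) (A.count true + 1) =
      prefRank m n A + m - n := by
  have hB : northIdx (true :: false :: B) = 0 :: (northIdx B).map (2 + ·) :=
    northIdx_append [true, false] B
  have hidx : (northIdx (A ++ true :: false :: B)).getD (A.count true) 0 = A.length := by
    rw [northIdx_append, ← length_northIdx, hB]
    simp
  have htake : (A ++ true :: false :: B).take (A.length + 2) = A ++ [true, false] := by
    simp [List.take_append]
  rw [afterBlockRank, Nat.add_sub_cancel, hidx, htake, prefRank_append]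
  simp [prefRank]
  ring

theorem exists_block_of_mem (Q : Path) (hQ : false ∈ Q) :
    ∃ a Q', Q = List.replicate a true ++ false :: Q' := by
  induction Q with
  | nil => simp at hQ
  | cons x Q ih =>
    cases x
    · exact ⟨0, Q, rfl⟩
    · obtain ⟨a, Q', rfl⟩ := ih (by simpa using hQ)
      exact ⟨a + 1, Q', rfl⟩

theorem IsDyck.prefRank_nonneg {m n : ℕ} {A B : Path} (hP : IsDyck m n (A ++ B)) :
    0 ≤ prefRank m n A := by
  simpa using hP.2.2 A.length (by simp)

/-- After a staircase prefix ending at rank less than `n`, a Dyck path continues with a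
nonempty block of north steps followed by an east step. -/
theorem IsDyck.exists_block {m n j : ℕ} (hmn : n < m) {Q : Path}
    (hP : IsDyck m n (stair j ++ Q)) (hj : (j : ℤ) * ((m : ℤ) - n) < n) :
    ∃ a Q', 0 < a ∧ Q = List.replicate a true ++ false :: Q' := by
  have hjm : j < m := by
    zify
    nlinarith
  have hQ : false ∈ Q := by
    have h := hP.1
    rw [List.count_append, count_false_stair] at h
    exact List.count_pos_iff.1 (by omega)
  obtain ⟨a, Q', rfl⟩ := exists_block_of_mem Q hQ
  refine ⟨a, Q', Nat.pos_of_ne_zero ?_, rfl⟩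
  rintro rfl
  have h : 0 ≤ prefRank m n (stair j ++ [false]) :=
    IsDyck.prefRank_nonneg (B := Q') (by simpa using hP)
  rw [prefRank_append, prefRank_stair] at h
  simp [prefRank] at h
  linarith

theorem afterBlockRank_stair_block (m n j : ℕ) {a : ℕ} (ha : 0 < a) (Q : Path) :
    afterBlockRank m n (stair j ++ (List.replicate a true ++ false :: Q)) (j + a) =
      j * ((m : ℤ) - n) + a * m - n := by
  obtain ⟨b, rfl⟩ := Nat.exists_eq_add_of_lt ha
  have h := afterBlockRank_append m n (stair j ++ List.replicate b true) Q
  rw [prefRank_append, prefRank_stair, List.count_append, count_true_stair] at h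
  simp only [zero_add, List.replicate_succ', List.append_assoc, List.cons_append,
    List.nil_append] at h ⊢
  simp [prefRank, add_assoc, List.count_replicate] at h ⊢
  rw [h]
  ring

theorem compType_stair_block (j : ℕ) {a : ℕ} (ha : 0 < a) (Q : Path) :
    compType (stair j ++ (List.replicate a true ++ false :: Q)) =
      List.replicate j 1 ++ a :: compType Q := by
  rw [compType_stair_append, compType_block ha]

theorem sum_take_compType_stair_block (j : ℕ) {a : ℕ} (ha : 0 < a) (Q : Path) :
    ((compType (stair j ++ (List.replicate a true ++ false :: Q))).take (j + 1)).sum =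
      j + a := by
  rw [compType_stair_block j ha]
  simp [List.take_append]

/-- If the first `s` points `e_i` have rank less than `n`, then the path starts with `(NE)^s`. -/
theorem IsDyck.exists_stair {m n : ℕ} (hn : 0 < n) (hmn : n < m) {P : Path} (hP : IsDyck m n P)
    {s : ℕ} (hs : ∀ i, 1 ≤ i → i ≤ s →
      afterBlockRank m n P (((compType P).take i).sum) < (n : ℤ)) :
    (∃ Q, P = stair s ++ Q) ∧ (s : ℤ) * ((m : ℤ) - n) < n := by
  induction s with
  | zero => exact ⟨⟨P, rfl⟩, by simpa using hn⟩
  | succ s ih =>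
    obtain ⟨⟨Q, rfl⟩, hr⟩ := ih fun i h1 h2 => hs i h1 (by omega)
    obtain ⟨a, Q, ha, rfl⟩ := hP.exists_block hmn hr
    have h := hs (s + 1) (by omega) le_rfl
    rw [sum_take_compType_stair_block s ha, afterBlockRank_stair_block m n s ha] at h
    have ha1 : a = 1 := by
      by_contra hne
      have h2 : (2 : ℤ) ≤ a := by exact_mod_cast (by omega : 2 ≤ a)
      have hmn' : (n : ℤ) < m := by exact_mod_cast hmn
      nlinarith [mul_nonneg (Int.natCast_nonneg s) (sub_nonneg.2 hmn'.le)]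
    subst ha1
    refine ⟨⟨Q, by simp [stair_succ]⟩, ?_⟩
    push_cast at h ⊢
    linarith

theorem iones_replicate_append (j : ℕ) (l : List ℕ) :
    iones (List.replicate j 1 ++ l) = j + iones l := by
  induction j with
  | zero => simp
  | succ j ih =>
    have h (l : List ℕ) : iones (1 :: l) = iones l + 1 := by simp [iones]
    rw [List.replicate_succ, List.cons_append, h, ih, Nat.add_right_comm]

/-- Let `m > n`, `P ∈ D_{m,n}` with `comp(P) = α = (α_1, …, α_ℓ)`, and
for `i ≤ ℓ` let `e_i` be the lattice point at the end of the east step immediately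
following the `i`-th maximal block of north steps of `P` (i.e. following the
`(α_1 + ⋯ + α_i)`-th north step).  If `s` is the largest integer `s ≥ 0` such that
`rank(e_i) < n` for all `1 ≤ i ≤ s`, then
`s + 1 = min(Iones(α) + 1, ⌈n/(m-n)⌉) = rr(α, m)`. -/
theorem rr_eq_formula (m n : ℕ) (hn : 0 < n) (hmn : n < m) (P : Path)
    (hP : IsDyck m n P) (α : List ℕ) (hα : compType P = α) (s : ℕ) (hsl : s ≤ α.length)
    (hs : ∀ i, 1 ≤ i → i ≤ s → afterBlockRank m n P ((α.take i).sum) < (n : ℤ))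
    (hmax : s < α.length → ¬ afterBlockRank m n P ((α.take (s + 1)).sum) < (n : ℤ)) :
    s + 1 = min (iones α + 1) ((n + (m - n) - 1) / (m - n)) ∧ s + 1 = rr m α := by
  subst hα
  have hsum : (compType P).sum = n := (sum_compType P).trans hP.2.1
  have key : s + 1 = min (iones (compType P) + 1) ((n + (m - n) - 1) / (m - n)) := by
    obtain ⟨⟨Q, rfl⟩, hr⟩ := hP.exists_stair hn hmn hs
    obtain ⟨a, Q, ha, rfl⟩ := hP.exists_block hmn hr
    rw [sum_take_compType_stair_block s ha, afterBlockRank_stair_block m n s ha] at hmax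
    rw [compType_stair_block s ha] at hmax ⊢
    have hge := hmax (by simp)
    rw [iones_replicate_append]
    obtain ⟨d, rfl⟩ := Nat.exists_eq_add_of_lt hmn
    have hd : n + d + 1 - n = d + 1 := by omega
    rw [hd]
    have hlow : s * (d + 1) < n := by
      zify
      push_cast at hr
      linarith
    have hceil : s + 1 ≤ (n + (d + 1) - 1) / (d + 1) := by
      rw [Nat.le_div_iff_mul_le d.succ_pos]
      linarith [show n + (d + 1) - 1 = n + d by omega]
    by_cases ha1 : a = 1
    · subst ha1
      have hup : n ≤ (s + 1) * (d + 1) := by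
        zify
        push_cast at hge
        linarith
      have hceil' : (n + (d + 1) - 1) / (d + 1) < s + 2 := by
        rw [Nat.div_lt_iff_lt_mul d.succ_pos]
        linarith [show n + (d + 1) - 1 = n + d by omega]
      have : 0 < iones (1 :: compType Q) := by simp [iones]
      omega
    · have : iones (a :: compType Q) = 0 := by simp [iones, ha1]
      omega
  exact ⟨key, by rw [rr, hsum]; exact key⟩

end RationalDyck
end

section
/- Let k ≥ 1 be an integer and n ≥ 0. Then ∑_{P ∈ D_{kn,n}} p^{run(P)} q^{ret(P)} r^{nc(P)} = ∑_{P ∈ D_{kn,n}} p^{ret(P)} q^{run(P)} r^{nc(P)} as polynomials in the indeterminates p, q, r; in particular, for k = 1 the joint distribution of (run, ret) refined by nc is symmetric on classical n×n Dyck paths. -/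
open scoped Classical

namespace RationalDyck

/-- Rooted plane trees; a forest is a list of plane trees. -/
inductive PlaneTree : Type
  | node : List PlaneTree → PlaneTree

open PlaneTree

theorem forest_induction {motive : List PlaneTree → Prop} (nil : motive [])
    (cons : ∀ c r, motive c → motive r → motive (node c :: r)) : ∀ f, motive f
  | [] => nil
  | node c :: r => cons c r (forest_induction nil cons c) (forest_induction nil cons r)

/-- The Łukasiewicz-type word of a forest: in preorder, each vertex with `k * a` children
contributes `a` north steps followed by one east step. -/
def word (k : ℕ) : List PlaneTree → Path
  | [] => []
  | node c :: r => List.replicate (c.length / k) true ++ false :: (word k c ++ word k r)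

/-- Every vertex has a number of children divisible by `k`. -/
def Divisible (k : ℕ) : List PlaneTree → Prop
  | [] => True
  | node c :: r => k ∣ c.length ∧ Divisible k c ∧ Divisible k r

/-- The mirror image of a forest. -/
def mirror : List PlaneTree → List PlaneTree
  | [] => []
  | node c :: r => mirror r ++ [node (mirror c)]

/-- The number of vertices of a forest. -/
def vertices : List PlaneTree → ℕ
  | [] => 0
  | node c :: r => 1 + vertices c + vertices r

/-- The number of vertices of a forest that have a child. -/
def internal : List PlaneTree → ℕ
  | [] => 0
  | node c :: r => (if c.length = 0 then 0 else 1) + internal c + internal r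

/-- The number of edges of the leftmost branch of a forest. -/
def leftDepth : List PlaneTree → ℕ
  | [] => 0
  | node c :: _ => if c.length = 0 then 0 else 1 + leftDepth c

/-- The number of edges of the rightmost branch of a forest. -/
def rightDepth : List PlaneTree → ℕ
  | [] => 0
  | node c :: r =>
    if r.length = 0 then (if c.length = 0 then 0 else 1 + rightDepth c) else rightDepth r

/-- The inverse of `word`. -/
def parse (k : ℕ) : Path → List PlaneTree
  | [] => []
  | false :: W => node [] :: parse k W
  | true :: W =>
    match parse k W with
    | [] => []
    | node c :: r => node (c ++ r.take k) :: r.drop k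

/-- The height change of a step, with respect to the line of slope `1 / k`. -/
def stepHeight (k : ℕ) (b : Bool) : ℤ := if b then k else -1

/-- The path starting at height `m` has positive height before each step and ends at
height `0`. -/
def FirstHits (k : ℕ) : ℤ → Path → Prop
  | m, [] => m = 0
  | m, b :: W => 0 < m ∧ FirstHits k (m + stepHeight k b) W

/-- The number of steps starting at height `0`, for a path starting at height `h`. -/
def zeros (k : ℕ) : ℤ → Path → ℕ
  | _, [] => 0
  | h, b :: W => (if h = 0 then 1 else 0) + zeros k (h + stepHeight k b) W

section Mirror

@[simp] theorem length_mirror (f : List PlaneTree) : (mirror f).length = f.length := by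
  induction f using forest_induction with
  | nil => simp [mirror]
  | cons c r _ ihr => simp [mirror, ihr]

theorem mirror_append (f g : List PlaneTree) : mirror (f ++ g) = mirror g ++ mirror f := by
  induction f using forest_induction with
  | nil => simp [mirror]
  | cons c r _ ihr => simp [mirror, ihr]

@[simp] theorem mirror_mirror (f : List PlaneTree) : mirror (mirror f) = f := by
  induction f using forest_induction with
  | nil => simp [mirror]
  | cons c r ihc ihr => simp [mirror, mirror_append, ihc, ihr]

theorem divisible_cons {k : ℕ} {c r : List PlaneTree} :
    Divisible k (node c :: r) ↔ k ∣ c.length ∧ Divisible k c ∧ Divisible k r := by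
  simp only [Divisible]

theorem divisible_append (k : ℕ) (f g : List PlaneTree) :
    Divisible k (f ++ g) ↔ Divisible k f ∧ Divisible k g := by
  induction f using forest_induction with
  | nil => simp [Divisible]
  | cons c r _ ihr => simp [Divisible, ihr, and_assoc]

theorem Divisible.mirror {k : ℕ} {f : List PlaneTree} (hf : Divisible k f) :
    Divisible k (mirror f) := by
  induction f using forest_induction with
  | nil => simp [RationalDyck.mirror, Divisible]
  | cons c r ihc ihr =>
    simp only [Divisible] at hf
    simp [RationalDyck.mirror, divisible_append, Divisible, ihc hf.2.1, ihr hf.2.2, hf.1]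

theorem vertices_append (f g : List PlaneTree) :
    vertices (f ++ g) = vertices f + vertices g := by
  induction f using forest_induction with
  | nil => simp [vertices]
  | cons c r _ ihr => simp [vertices, ihr, add_assoc]

theorem vertices_mirror (f : List PlaneTree) : vertices (mirror f) = vertices f := by
  induction f using forest_induction with
  | nil => simp [mirror]
  | cons c r ihc ihr => simp [mirror, vertices_append, vertices, ihc, ihr]; omega

theorem internal_append (f g : List PlaneTree) :
    internal (f ++ g) = internal f + internal g := by
  induction f using forest_induction with
  | nil => simp [internal]
  | cons c r _ ihr => simp [internal, ihr, add_assoc]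

theorem internal_mirror (f : List PlaneTree) : internal (mirror f) = internal f := by
  induction f using forest_induction with
  | nil => simp [mirror]
  | cons c r ihc ihr =>
    simp only [mirror, internal_append, internal, ihc, ihr, length_mirror]; omega

theorem leftDepth_append (f g : List PlaneTree) :
    leftDepth (f ++ g) = if f.length = 0 then leftDepth g else leftDepth f := by
  rcases f with _ | ⟨⟨c⟩, r⟩ <;> simp [leftDepth]

theorem leftDepth_mirror (f : List PlaneTree) : leftDepth (mirror f) = rightDepth f := by
  induction f using forest_induction with
  | nil => simp [mirror, leftDepth, rightDepth]
  | cons c r ihc ihr =>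
    simp only [mirror, leftDepth_append, leftDepth, rightDepth, ihc, ihr, length_mirror]

theorem rightDepth_mirror (f : List PlaneTree) : rightDepth (mirror f) = leftDepth f := by
  rw [← leftDepth_mirror, mirror_mirror]

end Mirror

section Parsing

theorem word_append (k : ℕ) (f g : List PlaneTree) :
    word k (f ++ g) = word k f ++ word k g := by
  induction f using forest_induction with
  | nil => simp [word]
  | cons c r _ ihr => simp [word, ihr]

theorem parse_replicate (k a : ℕ) (W : Path) :
    parse k (List.replicate a true ++ false :: W) =
      node ((parse k W).take (a * k)) :: (parse k W).drop (a * k) := by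
  induction a with
  | zero => simp [parse]
  | succ a ih =>
    simp only [List.replicate_succ, List.cons_append, parse, ih, List.drop_drop, add_mul, one_mul,
      List.take_add]

theorem parse_word_append {k : ℕ} {f : List PlaneTree} (hf : Divisible k f) (W : Path) :
    parse k (word k f ++ W) = f ++ parse k W := by
  induction f using forest_induction generalizing W with
  | nil => simp [word]
  | cons c r ihc ihr =>
    obtain ⟨hd, hc, hr⟩ := divisible_cons.1 hf
    simp [word, parse_replicate, ihc hc, ihr hr, Nat.div_mul_cancel hd]

theorem parse_word {k : ℕ} {f : List PlaneTree} (hf : Divisible k f) :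
    parse k (word k f) = f := by
  simpa [parse] using parse_word_append hf []

theorem FirstHits.parse_spec {k : ℕ} (hk : 1 ≤ k) {m : ℤ} {W : Path} (hW : FirstHits k m W) :
    ((parse k W).length : ℤ) = m ∧ Divisible k (parse k W) ∧ word k (parse k W) = W := by
  induction W generalizing m with
  | nil => simp_all [FirstHits, parse, Divisible, word]
  | cons b W ih =>
    obtain ⟨hm, hW⟩ := hW
    obtain ⟨hl, hd, hw⟩ := ih hW
    cases b with
    | false =>
      simp only [stepHeight, Bool.false_eq_true, if_false] at hl
      simp only [parse, List.length_cons, Divisible, word, hd, hw]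
      refine ⟨by push_cast; omega, by simp, by simp⟩
    | true =>
      simp only [stepHeight, if_true] at hl
      rcases hp : parse k W with _ | ⟨⟨c⟩, r⟩
      · simp [hp] at hl; omega
      · rw [hp] at hl hd hw
        simp only [List.length_cons, Nat.cast_add, Nat.cast_one] at hl
        have hr : k ≤ r.length := by omega
        obtain ⟨hdvd, hc, hdr⟩ := divisible_cons.1 hd
        rw [← List.take_append_drop k r, divisible_append] at hdr
        have hlen : (c ++ r.take k).length = c.length + k := by simp [hr]
        simp only [parse, hp, Divisible, hlen, divisible_append, word, word_append,
          Nat.add_div_right _ hk]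
        refine ⟨by simp; omega, ⟨(Nat.dvd_add_right hdvd).2 dvd_rfl, ⟨hc, hdr.1⟩, hdr.2⟩, ?_⟩
        rw [← hw, word]
        conv_rhs => rw [← List.take_append_drop k r, word_append]
        simp [List.replicate_succ]

theorem firstHits_replicate {k a : ℕ} {m : ℤ} (hm : 0 < m) (W : Path) :
    FirstHits k m (List.replicate a true ++ W) ↔ FirstHits k (m + a * k) W := by
  induction a generalizing m with
  | zero => simp
  | succ a ih =>
    simp only [List.replicate_succ, List.cons_append, FirstHits, hm, true_and, stepHeight, if_true]
    rw [ih (by omega)]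
    push_cast
    ring_nf

theorem firstHits_word_append {k : ℕ} {f : List PlaneTree} (hf : Divisible k f) {m : ℤ}
    (hm : 0 ≤ m) (W : Path) :
    FirstHits k (f.length + m) (word k f ++ W) ↔ FirstHits k m W := by
  induction f using forest_induction generalizing m W with
  | nil => simp [word]
  | cons c r ihc ihr =>
    obtain ⟨hd, hc, hr⟩ := divisible_cons.1 hf
    have hcast : ((c.length / k : ℕ) : ℤ) * k = c.length := by
      exact_mod_cast Nat.div_mul_cancel hd
    rw [← ihr hr hm W, ← ihc hc (m := r.length + m) (by omega) (word k r ++ W)]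
    simp only [word, List.append_assoc, List.cons_append, List.length_cons]
    rw [firstHits_replicate (by push_cast; omega), hcast, FirstHits]
    have h : ((r.length + 1 : ℕ) : ℤ) + m + c.length + stepHeight k false =
        c.length + (r.length + m) := by
      simp [stepHeight]; ring
    rw [h]
    refine and_iff_right ?_
    push_cast; omega

theorem firstHits_word {k : ℕ} {f : List PlaneTree} (hf : Divisible k f) :
    FirstHits k f.length (word k f) := by
  simpa using (firstHits_word_append hf le_rfl []).2 rfl

theorem FirstHits.count {k : ℕ} {m : ℤ} {W : Path} (hW : FirstHits k m W) :
    m + k * W.count true = W.count false := by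
  induction W generalizing m with
  | nil => simpa [FirstHits] using hW
  | cons b W ih =>
    have h := ih hW.2
    cases b <;> simp [stepHeight] at h ⊢ <;> linarith

theorem FirstHits.exists_append {k : ℕ} {m : ℤ} {W : Path} (hW : FirstHits k m W) (hm : 0 < m) :
    ∃ P, W = P ++ [false] := by
  induction W generalizing m with
  | nil => exact absurd hW hm.ne'
  | cons b W ih =>
    rcases W with _ | ⟨b', W⟩
    · cases b with
      | false => exact ⟨[], rfl⟩
      | true =>
        have h := hW.2
        simp [FirstHits, stepHeight] at h
        omega
    · obtain ⟨P, hP⟩ := ih hW.2 hW.2.1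
      exact ⟨b :: P, by simp [hP]⟩

theorem count_false_word (k : ℕ) (f : List PlaneTree) :
    (word k f).count false = vertices f := by
  induction f using forest_induction with
  | nil => simp [word, vertices]
  | cons c r ihc ihr =>
    simp [word, vertices, ihc, ihr, List.count_replicate]; omega

end Parsing

section Dyck

theorem firstHits_append_false_iff {k : ℕ} {m : ℤ} {P : Path} :
    FirstHits k m (P ++ [false]) ↔
      (∀ i ≤ P.length, 0 < m + k * (P.take i).count true - (P.take i).count false) ∧
        m + k * P.count true - P.count false = 1 := by
  induction P generalizing m with
  | nil => simp [FirstHits, stepHeight]; omega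
  | cons b P ih =>
    have key : ∀ Q : Path, m + stepHeight k b + k * Q.count true - Q.count false =
        m + k * (b :: Q).count true - (b :: Q).count false := by
      intro Q
      cases b <;> simp [stepHeight] <;> ring
    simp only [List.cons_append, FirstHits, ih, key]
    rw [← and_assoc]
    refine and_congr_left fun _ => ⟨?_, ?_⟩
    · rintro ⟨h0, h⟩ (_ | i) hi
      · simpa using h0
      · simpa using h i (by simpa using hi)
    · intro h
      refine ⟨by simpa using h 0 (by simp), fun i hi => ?_⟩
      simpa using h (i + 1) (by simpa using hi)

theorem prefRank_mul (k n : ℕ) (Q : Path) :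
    prefRank (k * n) n Q = n * (k * Q.count true - Q.count false) := by
  simp [prefRank]; ring

theorem isDyck_mul_iff {k n : ℕ} {P : Path} :
    IsDyck (k * n) n P ↔ P.count true = n ∧ FirstHits k 1 (P ++ [false]) := by
  rw [firstHits_append_false_iff]
  constructor
  · rintro ⟨hf, ht, h⟩
    refine ⟨ht, fun i hi => ?_, by rw [hf, ht]; push_cast; ring⟩
    rcases Nat.eq_zero_or_pos n with rfl | hn
    · have h1 : (P.take i).count false ≤ P.count false := (List.take_sublist i P).count_le _
      have h2 : (0 : ℤ) ≤ k * (P.take i).count true := by positivity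
      simp only [mul_zero] at hf
      omega
    · have h1 := h i hi
      rw [prefRank_mul] at h1
      have := nonneg_of_mul_nonneg_right h1 (by exact_mod_cast hn)
      linarith
  · rintro ⟨ht, h, he⟩
    refine ⟨?_, ht, fun i hi => ?_⟩
    · rw [ht] at he
      zify
      linarith
    · rw [prefRank_mul]
      exact mul_nonneg (by positivity) (by linarith [h i hi])

theorem mem_dyckPaths {m n : ℕ} {P : Path} : P ∈ dyckPaths m n ↔ IsDyck m n P := by
  simp only [dyckPaths, Finset.mem_filter, Finset.mem_image, Finset.mem_univ, true_and,
    and_iff_right_iff_imp]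
  rintro ⟨hf, ht, -⟩
  have hl : P.length = m + n := by
    rw [← hf, ← ht, add_comm, List.count_true_add_count_false]
  subst_vars
  rw [← hl]
  exact ⟨P.get, List.ofFn_get P⟩

end Dyck

section Statistics

theorem nc_append_false (A B : Path) : nc (A ++ false :: B) = nc A + nc B := by
  simp [nc, compType, List.splitOn_append_cons_self]

theorem nc_replicate (a : ℕ) : nc (List.replicate a true) = if a = 0 then 0 else 1 := by
  have : (List.replicate a true).splitOn false = [List.replicate a true] :=
    List.splitOn_eq_singleton (by simp)
  simp [nc, compType, this]
  split_ifs <;> simp_all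

theorem nc_word_append {k : ℕ} {f : List PlaneTree} (hk : 1 ≤ k) (hf : Divisible k f) (W : Path) :
    nc (word k f ++ W) = internal f + nc W := by
  induction f using forest_induction generalizing W with
  | nil => simp [word, internal]
  | cons c r ihc ihr =>
    obtain ⟨hd, hc, hr⟩ := divisible_cons.1 hf
    have h : c.length / k = 0 ↔ c.length = 0 := by
      obtain ⟨a, ha⟩ := hd
      rw [ha, Nat.mul_div_cancel_left _ hk]
      simp; omega
    simp [word, internal, nc_append_false, nc_replicate, ihc hc, ihr hr, h]
    omega

theorem coarea_nil : coarea [] = [] := rfl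

theorem coarea_cons_true (P : Path) : coarea (true :: P) = 0 :: coarea P := by
  simp [coarea, List.range_succ_eq_map, List.filterMap_map]

theorem coarea_cons_false (P : Path) : coarea (false :: P) = (coarea P).map (· + 1) := by
  simp only [coarea, List.length_cons, List.range_succ_eq_map, List.filterMap_cons,
    List.filterMap_map, List.map_filterMap]
  simp [apply_ite]

theorem coarea_append_false (P : Path) : coarea (P ++ [false]) = coarea P := by
  induction P with
  | nil => simp [coarea_cons_false, coarea_nil]
  | cons b P ih => cases b <;> simp [coarea_cons_false, coarea_cons_true, ih]

theorem zero_mem_coarea_replicate {a : ℕ} {W : Path} :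
    0 ∈ coarea (List.replicate a true ++ false :: W) ↔ a ≠ 0 := by
  cases a <;> simp [List.replicate_succ, coarea_cons_true, coarea_cons_false]

theorem succ_mem_coarea_replicate {a i : ℕ} {W : Path} :
    i + 1 ∈ coarea (List.replicate a true ++ false :: W) ↔ i ∈ coarea W := by
  induction a <;> simp_all [List.replicate_succ, coarea_cons_true, coarea_cons_false]

theorem mem_coarea_word_append {k : ℕ} {f : List PlaneTree} (hk : 1 ≤ k) (hf : Divisible k f)
    (hne : f ≠ []) (W : Path) :
    (∀ i < leftDepth f, i ∈ coarea (word k f ++ W)) ∧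
      leftDepth f ∉ coarea (word k f ++ W) := by
  induction f using forest_induction generalizing W with
  | nil => exact absurd rfl hne
  | cons c r ihc _ =>
    obtain ⟨hd, hc, -⟩ := divisible_cons.1 hf
    obtain ⟨a, ha⟩ := hd
    have hdiv : c.length / k = a := by rw [ha, Nat.mul_div_cancel_left _ hk]
    simp only [word, leftDepth, hdiv, List.append_assoc, List.cons_append]
    by_cases h0 : c.length = 0
    · have ha0 : a = 0 := by
        rw [h0] at ha
        rcases Nat.mul_eq_zero.1 ha.symm with h | h <;> omega
      simp [h0, ha0, coarea_cons_false]
    · have ha0 : a ≠ 0 := by rintro rfl; simp_all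
      have ih := ihc hc (by rintro rfl; simp at h0) (word k r ++ W)
      rw [if_neg h0, add_comm 1, succ_mem_coarea_replicate]
      refine ⟨?_, ih.2⟩
      rintro (_ | i) hi
      · exact zero_mem_coarea_replicate.2 ha0
      · exact succ_mem_coarea_replicate.2 (ih.1 i (by omega))

theorem leftDepth_le_count {k : ℕ} {f : List PlaneTree} (hk : 1 ≤ k) (hf : Divisible k f) :
    leftDepth f ≤ (word k f).count true := by
  induction f using forest_induction with
  | nil => simp [leftDepth]
  | cons c r ihc _ =>
    obtain ⟨hd, hc, -⟩ := divisible_cons.1 hf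
    have := ihc hc
    rw [leftDepth, word, List.count_append, List.count_replicate_self,
      List.count_cons_of_ne (by simp), List.count_append]
    split_ifs with h0
    · exact Nat.zero_le _
    · have : 0 < c.length / k := Nat.div_pos (Nat.le_of_dvd (by omega) hd) hk
      omega

theorem runStat_eq_leftDepth {k : ℕ} {f : List PlaneTree} {P : Path} (hk : 1 ≤ k)
    (hf : Divisible k f) (hlen : f.length = 1) (hP : word k f = P ++ [false]) :
    runStat P = leftDepth f := by
  have hne : f ≠ [] := by rintro rfl; simp at hlen
  obtain ⟨h1, h2⟩ := mem_coarea_word_append hk hf hne []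
  have hle := leftDepth_le_count hk hf
  simp only [List.append_nil, hP, coarea_append_false] at h1 h2
  simp only [hP, List.count_append] at hle
  have hle' : leftDepth f ≤ P.count true := by simpa using hle
  by_cases h0 : leftDepth f = 0
  · have hc : P.count true = 0 := by
      obtain ⟨⟨c⟩, rfl⟩ := List.length_eq_one_iff.1 hlen
      have hc : c = [] := by
        by_contra h
        simp [leftDepth, h] at h0
      subst hc
      have hP' : [false] = P ++ [false] := by simpa [word] using hP
      have : P = [] := by simpa using hP'
      simp [this]
    rw [h0, runStat]
    simp only [hc]
    convert Nat.sInf_empty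
    ext i
    simp; omega
  · refine IsLeast.csInf_eq ⟨⟨by omega, hle', h2⟩, fun i hi => ?_⟩
    by_contra hlt
    exact hi.2.2 (h1 i (by omega))

theorem zeros_append (k : ℕ) (h : ℤ) (A B : Path) :
    zeros k h (A ++ B) =
      zeros k h A + zeros k (h + k * A.count true - A.count false) B := by
  induction A generalizing h with
  | nil => simp [zeros]
  | cons b A ih =>
    have : h + stepHeight k b + k * A.count true - A.count false =
        h + k * (b :: A).count true - (b :: A).count false := by
      cases b <;> simp [stepHeight] <;> ring
    simp only [List.cons_append, zeros, ih, this]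
    omega

theorem zeros_replicate {k a : ℕ} {h : ℤ} (hh : 0 < h) :
    zeros k h (List.replicate a true) = 0 := by
  induction a generalizing h with
  | zero => simp [zeros]
  | succ a ih =>
    simp only [List.replicate_succ, zeros, stepHeight, if_true]
    rw [ih (by omega), if_neg hh.ne']

theorem zeros_block {k a : ℕ} {h : ℤ} (hk : 1 ≤ k) (hh : 0 ≤ h) (W : Path) :
    zeros k h (List.replicate a true ++ false :: W) =
      (if h = 0 then 1 else 0) + zeros k (h + a * k - 1) W := by
  have key : ∀ (a : ℕ) (h' : ℤ), 0 < h' → zeros k h' (List.replicate a true ++ false :: W) =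
      zeros k (h' + a * k - 1) W := by
    intro a h' hh'
    have : 0 ≤ (k : ℤ) * a := by positivity
    rw [zeros_append, zeros_replicate hh', zeros]
    simp only [List.count_replicate, stepHeight]
    simp only [BEq.rfl, if_true, beq_iff_eq, Bool.true_eq_false, if_false, Nat.cast_zero, sub_zero,
      Bool.false_eq_true]
    rw [if_neg (by omega)]
    simp [mul_comm, sub_eq_add_neg]
  rcases hh.eq_or_lt with rfl | hpos
  · rcases a with _ | a
    · simp [zeros, stepHeight]
    · rw [List.replicate_succ, List.cons_append, zeros, stepHeight, if_pos rfl,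
        key a _ (by rw [if_pos rfl]; omega)]
      push_cast
      simp
      ring_nf
  · rw [key a h hpos, if_neg hpos.ne', zero_add]

theorem zeros_word_append_of_pos {k : ℕ} {f : List PlaneTree} (hk : 1 ≤ k) (hf : Divisible k f)
    {s : ℤ} (hs : 0 < s) (W : Path) :
    zeros k (f.length + s - 1) (word k f ++ W) = zeros k (s - 1) W := by
  induction f using forest_induction generalizing s W with
  | nil => simp [word]
  | cons c r ihc ihr =>
    obtain ⟨hd, hc, hr⟩ := divisible_cons.1 hf
    have hcast : ((c.length / k : ℕ) : ℤ) * k = c.length := by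
      exact_mod_cast Nat.div_mul_cancel hd
    simp only [word, List.append_assoc, List.cons_append, List.length_cons]
    rw [zeros_block hk (by push_cast; omega), hcast, if_neg (by push_cast; omega), ← ihr hr hs W,
      ← ihc hc (s := r.length + s) (by omega) (word k r ++ W)]
    push_cast
    ring_nf

theorem zeros_word_append {k : ℕ} {f : List PlaneTree} (hk : 1 ≤ k) (hf : Divisible k f)
    (hne : f ≠ []) (W : Path) :
    zeros k (f.length - 1) (word k f ++ W) = rightDepth f + 1 + zeros k (-1) W := by
  induction f using forest_induction generalizing W with
  | nil => exact absurd rfl hne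
  | cons c r ihc ihr =>
    obtain ⟨hd, hc, hr⟩ := divisible_cons.1 hf
    have hcast : ((c.length / k : ℕ) : ℤ) * k = c.length := by
      exact_mod_cast Nat.div_mul_cancel hd
    simp only [word, List.append_assoc, List.cons_append, List.length_cons, rightDepth]
    rw [zeros_block hk (by push_cast; omega), hcast]
    rcases r with _ | ⟨t, r⟩
    · rcases c with _ | ⟨u, c⟩
      · simp [word]
      · have := ihc hc (by simp) W
        simp [word] at this ⊢
        rw [this]
        ring
    · rw [if_neg (by push_cast [List.length_cons]; omega), if_neg (by simp), ← ihr hr (by simp) W,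
        ← zeros_word_append_of_pos hk hc (s := (t :: r).length) (by simp)]
      push_cast
      ring_nf

theorem zeros_eq_length_filter (k : ℕ) (h : ℤ) (P : Path) :
    zeros k h P = ((List.range P.length).filter fun i =>
      h + k * (P.take i).count true - (P.take i).count false = 0).length := by
  induction P generalizing h with
  | nil => simp [zeros]
  | cons b P ih =>
    have : ∀ Q : Path, h + stepHeight k b + k * Q.count true - Q.count false =
        h + k * (b :: Q).count true - (b :: Q).count false := by
      intro Q
      cases b <;> simp [stepHeight] <;> ring
    simp only [zeros, ih, this, List.length_cons, List.range_succ_eq_map, List.filter_cons,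
      List.filter_map, Function.comp_def, List.take_succ_cons]
    by_cases h0 : h = 0
    · simp [h0, add_comm]
    · rw [if_neg h0, if_neg (by simpa using h0), zero_add, List.length_map]
      congr!

theorem retStat_eq_zeros {k n : ℕ} {P : Path} (hP : IsDyck (k * n) n P) :
    retStat (k * n) n P = zeros k 0 P := by
  rw [zeros_eq_length_filter, retStat]
  congr 1
  refine List.filter_congr fun i hi => ?_
  have hi' := List.mem_range.1 hi
  have hpos := hP.2.2 i hi'.le
  have hn : 0 < n := by
    rcases Nat.eq_zero_or_pos n with rfl | hn
    · have := List.count_true_add_count_false P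
      rw [hP.1, hP.2.1] at this
      omega
    · exact hn
  rw [prefRank_mul] at hpos ⊢
  have hpos' := nonneg_of_mul_nonneg_right hpos (by exact_mod_cast hn)
  have hn' : (0 : ℤ) < n := by exact_mod_cast hn
  simp only [decide_eq_decide, zero_add]
  constructor
  · intro h
    have : (k * (P.take i).count true - (P.take i).count false : ℤ) < 1 := by
      by_contra hge
      nlinarith
    omega
  · intro h
    rw [h]
    simpa using hn

theorem retStat_eq_rightDepth {k n : ℕ} {f : List PlaneTree} {P : Path} (hk : 1 ≤ k)
    (hf : Divisible k f) (hlen : f.length = 1) (hP : word k f = P ++ [false])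
    (hD : IsDyck (k * n) n P) : retStat (k * n) n P = rightDepth f := by
  have h := zeros_word_append hk hf (by rintro rfl; simp at hlen) []
  rw [List.append_nil, hP, zeros_append, hlen, hD.1, hD.2.1] at h
  simp [zeros] at h
  rw [retStat_eq_zeros hD, h]

theorem nc_eq_internal {k : ℕ} {f : List PlaneTree} {P : Path} (hk : 1 ≤ k)
    (hf : Divisible k f) (hP : word k f = P ++ [false]) : nc P = internal f := by
  have h0 : nc [] = 0 := by simpa using nc_replicate 0
  have h := nc_word_append hk hf []
  rw [List.append_nil, hP, nc_append_false, h0] at h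
  simpa using h

end Statistics

section Involution

/-- The path obtained by mirroring the plane tree encoded by a path. -/
def mirrorPath (k : ℕ) (P : Path) : Path := (word k (mirror (parse k (P ++ [false])))).dropLast

theorem word_mirror_parse {k n : ℕ} (hk : 1 ≤ k) {P : Path} (hP : IsDyck (k * n) n P) :
    word k (mirror (parse k (P ++ [false]))) = mirrorPath k P ++ [false] := by
  obtain ⟨hl, hd, -⟩ := (isDyck_mul_iff.1 hP).2.parse_spec hk
  have h := firstHits_word hd.mirror
  obtain ⟨Q, hQ⟩ := h.exists_append (by simp [hl])
  rw [mirrorPath, hQ, List.dropLast_concat]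

theorem IsDyck.mirrorPath {k n : ℕ} (hk : 1 ≤ k) {P : Path} (hP : IsDyck (k * n) n P) :
    IsDyck (k * n) n (mirrorPath k P) := by
  obtain ⟨ht, hfh⟩ := isDyck_mul_iff.1 hP
  obtain ⟨hl, hd, hw⟩ := hfh.parse_spec hk
  have h := firstHits_word hd.mirror
  rw [length_mirror, hl, word_mirror_parse hk hP] at h
  refine isDyck_mul_iff.2 ⟨?_, h⟩
  have h1 := h.count
  have h2 := hfh.count
  rw [← word_mirror_parse hk hP, count_false_word, vertices_mirror, ← count_false_word k, hw,
    ← h2, word_mirror_parse hk hP] at h1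
  have hk' : (k : ℤ) ≠ 0 := by positivity
  have h3 := mul_left_cancel₀ hk' (add_left_cancel h1)
  simp only [List.count_append, ht] at h3
  simpa using h3

theorem parse_mirrorPath {k n : ℕ} (hk : 1 ≤ k) {P : Path} (hP : IsDyck (k * n) n P) :
    parse k (mirrorPath k P ++ [false]) = mirror (parse k (P ++ [false])) := by
  obtain ⟨-, hd, -⟩ := (isDyck_mul_iff.1 hP).2.parse_spec hk
  rw [← word_mirror_parse hk hP, parse_word hd.mirror]

theorem mirrorPath_mirrorPath {k n : ℕ} (hk : 1 ≤ k) {P : Path} (hP : IsDyck (k * n) n P) :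
    mirrorPath k (mirrorPath k P) = P := by
  obtain ⟨-, -, hw⟩ := (isDyck_mul_iff.1 hP).2.parse_spec hk
  rw [mirrorPath, parse_mirrorPath hk hP, mirror_mirror, hw, List.dropLast_concat]

theorem stats_eq {k n : ℕ} (hk : 1 ≤ k) {P : Path} (hP : IsDyck (k * n) n P) :
    runStat P = leftDepth (parse k (P ++ [false])) ∧
      retStat (k * n) n P = rightDepth (parse k (P ++ [false])) ∧
      nc P = internal (parse k (P ++ [false])) := by
  obtain ⟨hl, hd, hw⟩ := (isDyck_mul_iff.1 hP).2.parse_spec hk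
  have hl' : (parse k (P ++ [false])).length = 1 := by exact_mod_cast hl
  exact ⟨runStat_eq_leftDepth hk hd hl' hw, retStat_eq_rightDepth hk hd hl' hw hP,
    nc_eq_internal hk hd hw⟩

end Involution

open MvPolynomial in
/-- For `k ≥ 1` and `n ≥ 0`, the joint distribution of `(run, ret)`
refined by `nc` is symmetric on `k`-Dyck paths `D_{kn,n}`, as an identity of polynomials
in `p = X 0`, `q = X 1`, `r = X 2`. -/
theorem run_ret_nc_symmetric_kDyck (k n : ℕ) (hk : 1 ≤ k) :
    (∑ P ∈ dyckPaths (k * n) n,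
        (X 0 : MvPolynomial (Fin 3) ℚ) ^ runStat P * (X 1) ^ retStat (k * n) n P *
          (X 2) ^ nc P) =
      ∑ P ∈ dyckPaths (k * n) n,
        (X 0 : MvPolynomial (Fin 3) ℚ) ^ retStat (k * n) n P * (X 1) ^ runStat P *
          (X 2) ^ nc P := by
  refine Finset.sum_nbij' (mirrorPath k) (mirrorPath k)
    (fun P hP => mem_dyckPaths.2 ((mem_dyckPaths.1 hP).mirrorPath hk))
    (fun P hP => mem_dyckPaths.2 ((mem_dyckPaths.1 hP).mirrorPath hk))
    (fun P hP => mirrorPath_mirrorPath hk (mem_dyckPaths.1 hP))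
    (fun P hP => mirrorPath_mirrorPath hk (mem_dyckPaths.1 hP)) fun P hP => ?_
  have hD := mem_dyckPaths.1 hP
  obtain ⟨h1, h2, h3⟩ := stats_eq hk hD
  obtain ⟨h1', h2', h3'⟩ := stats_eq hk (hD.mirrorPath hk)
  rw [h1, h2, h3, h1', h2', h3', parse_mirrorPath hk hD, leftDepth_mirror, rightDepth_mirror,
    internal_mirror]

end RationalDyck
end
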